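/- arXiv:2212.13806 — 2 statements merged into one kernel-verified Lean document; each statement's English description precedes it below -/
import Mathlib

section
/- Let m, n be positive integers. The invariant ring R_{m,n} = ℂ[X₁,…,Xₙ]^{GLₘ}, consisting of all polynomials f in the entries of the generic m×m matrices X₁,…,Xₙ satisfying f(gX₁g⁻¹,…,gXₙg⁻¹) = f(X₁,…,Xₙ) for all g ∈ GLₘ(ℂ), is generated as a ℂ-algebra by the trace polynomials Tr(X_{i₁}⋯X_{i_k}) of words in the generic matrices (first fundamental theorem of matrix invariants). -/
/-- The `k`-th generic `m × m` matrix `Xₖ = (x^k_{ij})_{ij}`, a matrix over the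
polynomial ring `ℂ[x^k_{ij} : 1 ≤ i,j ≤ m, 1 ≤ k ≤ n]`. -/
noncomputable def genMat (m n : ℕ) (k : Fin n) :
    Matrix (Fin m) (Fin m) (MvPolynomial (Fin n × Fin m × Fin m) ℂ) :=
  Matrix.of fun i j => MvPolynomial.X (k, i, j)

/-- The trace `Tr(X_{i₁} ⋯ X_{i_k})` of the word `w = (i₁, …, i_k)` in the generic
matrices. -/
noncomputable def traceWord (m n : ℕ) (w : List (Fin n)) :
    MvPolynomial (Fin n × Fin m × Fin m) ℂ :=
  Matrix.trace (w.map (genMat m n)).prod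

/-- `f` is invariant under simultaneous conjugation of the generic matrices
`X₁, …, Xₙ` by every invertible complex `m × m` matrix `g`, i.e.
`f(gX₁g⁻¹, …, gXₙg⁻¹) = f(X₁, …, Xₙ)` for all `g ∈ GLₘ(ℂ)`. -/
def IsConjInvariant {m n : ℕ} (f : MvPolynomial (Fin n × Fin m × Fin m) ℂ) : Prop :=
  ∀ g : Matrix (Fin m) (Fin m) ℂ, IsUnit g →
    MvPolynomial.aeval
      (fun v : Fin n × Fin m × Fin m =>
        (g.map MvPolynomial.C * genMat m n v.1 * g⁻¹.map MvPolynomial.C :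
          Matrix (Fin m) (Fin m) (MvPolynomial (Fin n × Fin m × Fin m) ℂ)) v.2.1 v.2.2) f = f

open MvPolynomial in
theorem prod_X_eq_monomial_sum_single {α V : Type*} [Fintype α] (w : α → V) :
    ∏ t, (X (w t) : MvPolynomial V ℂ) = monomial (∑ t, Finsupp.single (w t) 1) 1 := by
  rw [monomial_sum_one]
  rfl

theorem exists_perm_comp_eq_of_sum_single_eq {α V : Type*} [Fintype α] (w w' : α → V)
    (h : ∑ t, Finsupp.single (w t) 1 = ∑ t, Finsupp.single (w' t) 1) :
    ∃ σ : Equiv.Perm α, w' ∘ σ = w := by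
  classical
  have hcard : ∀ v, Nonempty ({t // w t = v} ≃ {t // w' t = v}) := fun v => by
    rw [← Fintype.card_eq]
    have := DFunLike.congr_fun h v
    simpa [Finsupp.finsetSum_apply, Finsupp.single_apply, Fintype.card_subtype] using this
  exact ⟨Equiv.ofFiberEquiv fun v => (hcard v).some, funext fun t => Equiv.ofFiberEquiv_map _ t⟩

theorem exists_sum_single_eq_of_degree_eq {V : Type*} {d : ℕ} (s : V →₀ ℕ) (hs : s.degree = d) :
    ∃ w : Fin d → V, ∑ t, Finsupp.single (w t) 1 = s := by
  classical
  obtain ⟨l, hl⟩ := Quotient.exists_rep s.toMultiset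
  have hlen : l.length = d := by
    rw [← hs, ← Multiset.coe_card]
    exact (congrArg _ hl).trans (Finsupp.card_toMultiset s)
  subst hlen
  refine ⟨l.get, Multiset.toFinsupp.symm.injective ?_⟩
  change Finsupp.toMultiset _ = Finsupp.toMultiset s
  rw [← hl, map_sum]
  simp only [Finsupp.toMultiset_single, one_smul]
  conv_rhs => rw [← List.ofFn_get l]
  refine Eq.trans ?_ (Fin.univ_val_map l.get)
  rw [← Multiset.sum_map_singleton (Multiset.map l.get _), Multiset.map_map]
  rfl

open MvPolynomial in
/-- A homogeneous polynomial is given by a symmetric tensor of coefficients. -/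
theorem exists_symmetric_coeff_of_isHomogeneous {V : Type*} [Fintype V] {d : ℕ}
    {f : MvPolynomial V ℂ} (hf : f.IsHomogeneous d) :
    ∃ c : (Fin d → V) → ℂ, (∀ (σ : Equiv.Perm (Fin d)) w, c (w ∘ σ) = c w) ∧
      f = ∑ w, C (c w) * ∏ t, X (w t) := by
  classical
  let mon : (Fin d → V) → V →₀ ℕ := fun w => ∑ t, Finsupp.single (w t) 1
  have hmon : ∀ (σ : Equiv.Perm (Fin d)) w, mon (w ∘ σ) = mon w := fun σ w =>
    Equiv.sum_comp σ fun t => Finsupp.single (w t) 1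
  refine ⟨fun w => coeff (mon w) f / (Finset.univ.filter fun w' => mon w' = mon w).card,
    fun σ w => by simp only [hmon], ?_⟩
  ext s
  simp only [prod_X_eq_monomial_sum_single, coeff_sum, coeff_C_mul, coeff_monomial, mul_ite,
    mul_one, mul_zero]
  change _ = ∑ w, if mon w = s then _ else _
  rw [← Finset.sum_filter]
  by_cases hs : ∃ w, mon w = s
  · obtain ⟨w₀, rfl⟩ := hs
    have hne : ((Finset.univ.filter fun w' => mon w' = mon w₀).card : ℂ) ≠ 0 := by
      simp only [ne_eq, Nat.cast_eq_zero, Finset.card_eq_zero]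
      exact Finset.Nonempty.ne_empty ⟨w₀, by simp⟩
    rw [Finset.sum_congr rfl (g := fun _ => coeff (mon w₀) f /
      (Finset.univ.filter fun w' => mon w' = mon w₀).card), Finset.sum_const, nsmul_eq_mul,
      mul_div_cancel₀ _ hne]
    intro w hw
    rw [(Finset.mem_filter.mp hw).2]
  · rw [Finset.sum_eq_zero]
    · refine hf.coeff_eq_zero fun hdeg => hs (exists_sum_single_eq_of_degree_eq s hdeg)
    · exact fun w hw => (hs ⟨w, (Finset.mem_filter.mp hw).2⟩).elim

open MvPolynomial in
/-- A symmetric tensor of coefficients is determined by its polynomial. -/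
theorem eq_of_symmetric_of_sum_eq {α V : Type*} [Fintype α] [DecidableEq α] [Fintype V]
    {c c' : (α → V) → ℂ}
    (hc : ∀ (σ : Equiv.Perm α) w, c (w ∘ σ) = c w)
    (hc' : ∀ (σ : Equiv.Perm α) w, c' (w ∘ σ) = c' w)
    (h : ∑ w, C (c w) * ∏ t, (X (w t) : MvPolynomial V ℂ) = ∑ w, C (c' w) * ∏ t, X (w t)) :
    c = c' := by
  classical
  funext w₀
  have key : ∀ b : (α → V) → ℂ, (∀ (σ : Equiv.Perm α) w, b (w ∘ σ) = b w) →
      coeff (∑ t, Finsupp.single (w₀ t) 1) (∑ w, C (b w) * ∏ t, (X (w t) : MvPolynomial V ℂ)) =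
        (Finset.univ.filter fun w : α → V =>
          ∑ t, Finsupp.single (w t) 1 = ∑ t, Finsupp.single (w₀ t) 1).card * b w₀ := by
    intro b hb
    simp only [prod_X_eq_monomial_sum_single, coeff_sum, coeff_C_mul, coeff_monomial, mul_ite,
      mul_one, mul_zero]
    rw [← Finset.sum_filter, ← nsmul_eq_mul]
    refine Finset.sum_eq_card_nsmul fun w hw => ?_
    obtain ⟨σ, rfl⟩ := exists_perm_comp_eq_of_sum_single_eq w w₀ (Finset.mem_filter.mp hw).2
    exact hb σ w₀
  have := congrArg (coeff (∑ t, Finsupp.single (w₀ t) 1)) h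
  rw [key c hc, key c' hc'] at this
  refine mul_left_cancel₀ ?_ this
  simp only [ne_eq, Nat.cast_eq_zero, Finset.card_eq_zero]
  exact Finset.Nonempty.ne_empty ⟨w₀, by simp⟩

open MvPolynomial in
theorem aeval_linear_sum_prod_X {α V : Type*} [Fintype α] [DecidableEq α] [Fintype V]
    (R : V → V → ℂ) (c : (α → V) → ℂ) :
    aeval (fun v => ∑ v', C (R v v') * (X v' : MvPolynomial V ℂ))
        (∑ w, C (c w) * ∏ t, (X (w t) : MvPolynomial V ℂ)) =
      ∑ w' : α → V, C (∑ w, c w * ∏ t, R (w t) (w' t)) * ∏ t, X (w' t) := by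
  simp only [map_sum, map_mul, map_prod, aeval_X, algHom_C, algebraMap_eq, Finset.sum_mul,
    Fintype.prod_sum]
  simp only [Finset.mul_sum, Finset.prod_mul_distrib]
  rw [Finset.sum_comm]
  simp only [mul_assoc]

/-- The representation of the permutation group of the factors on the tensor power
`(κ → ℂ)^{⊗ α}`, in coordinates. -/
def tensorPermRep (α κ : Type*) : Representation ℂ (Equiv.Perm α) ((α → κ) → ℂ) where
  toFun σ := LinearMap.funLeft ℂ ℂ fun I => I ∘ σ
  map_one' := rfl
  map_mul' _ _ := rfl

/-- A matrix commuting with all matrices invariant under permutations of the tensor factors is a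
linear combination of permutations. -/
theorem exists_eq_sum_perm_of_commute {α κ : Type*} [Fintype α] [DecidableEq α] [Fintype κ]
    [DecidableEq κ] (T : Matrix (α → κ) (α → κ) ℂ)
    (hT : ∀ A : Matrix (α → κ) (α → κ) ℂ,
      (∀ (σ : Equiv.Perm α) I J, A (I ∘ σ) (J ∘ σ) = A I J) → T * A = A * T) :
    ∃ a : Equiv.Perm α → ℂ, ∀ I J, T I J = ∑ σ : Equiv.Perm α, a σ * if I ∘ σ = J then 1 else 0 := by
  let ρ := tensorPermRep α κ
  let e := ρ.asModuleEquiv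
  have hcomm : ∀ (φ : Module.End (MonoidAlgebra ℂ (Equiv.Perm α)) ρ.asModule) (v : (α → κ) → ℂ),
      T.mulVec (e (φ (e.symm v))) = e (φ (e.symm (T.mulVec v))) := by
    intro φ
    let ψ : Module.End ℂ ((α → κ) → ℂ) :=
      e.toLinearMap ∘ₗ φ.restrictScalars ℂ ∘ₗ e.symm.toLinearMap
    have hψ : ∀ (σ : Equiv.Perm α) v, ψ (ρ σ v) = ρ σ (ψ v) := by
      intro σ v
      change e (φ (e.symm (ρ σ v))) = ρ σ (e (φ (e.symm v)))
      rw [Representation.asModuleEquiv_symm_map_rho, map_smul,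
        Representation.asModuleEquiv_map_smul, Representation.asAlgebraHom_of]
    have hA := hT (LinearMap.toMatrix' ψ) (by
      intro σ I J
      have h1 := congrFun (hψ σ (Pi.single (J ∘ σ) 1)) I
      have h2 : ρ σ (Pi.single (J ∘ σ) 1) = Pi.single J 1 := by
        ext K
        change (Pi.single (J ∘ σ) 1 : (α → κ) → ℂ) (K ∘ σ) = _
        simp only [Pi.single_apply, σ.surjective.injective_comp_right.eq_iff]
      rw [h2] at h1
      simp only [LinearMap.toMatrix'_apply]
      exact h1.symm)
    intro v
    have h3 := congrArg (fun B => Matrix.mulVec B v) hA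
    simp only [← Matrix.mulVec_mulVec, LinearMap.toMatrix'_mulVec] at h3
    exact h3
  let F : Module.End (Module.End (MonoidAlgebra ℂ (Equiv.Perm α)) ρ.asModule) ρ.asModule :=
    { toFun := fun v => e.symm (T.mulVec (e v))
      map_add' := fun v w => by simp only [map_add, Matrix.mulVec_add]
      map_smul' := fun φ v => by
        have := hcomm φ (e v)
        rw [e.symm_apply_apply] at this
        simp only [Module.End.smul_def, RingHom.id_apply, this, e.symm_apply_apply] }
  classical
  obtain ⟨r, hr⟩ := jacobson_density F
    (Finset.univ.image fun J : α → κ => e.symm (Pi.single J 1))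
  refine ⟨fun σ => r.coeff σ, fun I J => ?_⟩
  have h := congrArg e (hr _ (Finset.mem_image_of_mem _ (Finset.mem_univ J)))
  rw [Representation.asModuleEquiv_map_smul, Representation.asAlgebraHom_def,
    MonoidAlgebra.lift_apply, e.apply_symm_apply] at h
  have h' : T.mulVec (Pi.single J 1) I = _ := congrFun h I
  rw [Matrix.mulVec_single_one, Finsupp.sum_fintype _ _ (by simp), LinearMap.sum_apply,
    Finset.sum_apply] at h'
  refine h'.trans (Finset.sum_congr rfl fun σ _ => ?_)
  change _ * (Pi.single J 1 : (α → κ) → ℂ) (I ∘ σ) = _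
  rw [Pi.single_apply]

/-- The tensor power of a matrix, in coordinates. -/
def tensorPow (α : Type*) {κ : Type*} [Fintype α] (g : Matrix κ κ ℂ) :
    Matrix (α → κ) (α → κ) ℂ :=
  Matrix.of fun I J => ∏ t, g (I t) (J t)

theorem tensorPow_mul {α κ : Type*} [Fintype α] [DecidableEq α] [Fintype κ]
    (g h : Matrix κ κ ℂ) : tensorPow α (g * h) = tensorPow α g * tensorPow α h := by
  ext I J
  simp [tensorPow, Matrix.mul_apply, Fintype.prod_sum, Finset.prod_mul_distrib]

theorem tensorPow_one {α κ : Type*} [Fintype α] [DecidableEq α] [DecidableEq κ] :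
    tensorPow α (1 : Matrix κ κ ℂ) = 1 := by
  ext I J
  simp [tensorPow, Matrix.one_apply, Finset.prod_ite_zero, funext_iff]

open MvPolynomial in
/-- A matrix commuting with the tensor powers of all invertible matrices commutes with all
matrices invariant under permutations of the tensor factors. -/
theorem commute_of_commute_tensorPow {α κ : Type*} [Fintype α] [DecidableEq α] [Fintype κ]
    [DecidableEq κ] (T : Matrix (α → κ) (α → κ) ℂ)
    (hT : ∀ g : Matrix κ κ ℂ, IsUnit g → T * tensorPow α g = tensorPow α g * T)
    (A : Matrix (α → κ) (α → κ) ℂ)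
    (hA : ∀ (σ : Equiv.Perm α) I J, A (I ∘ σ) (J ∘ σ) = A I J) : T * A = A * T := by
  classical
  let mon : (α → κ) → (α → κ) → (κ × κ →₀ ℕ) := fun I J => ∑ t, Finsupp.single (I t, J t) 1
  let a : (κ × κ →₀ ℕ) → ℂ := fun s =>
    if h : ∃ p : (α → κ) × (α → κ), mon p.1 p.2 = s then A h.choose.1 h.choose.2 else 0
  have ha : ∀ I J, a (mon I J) = A I J := by
    intro I J
    have h : ∃ p : (α → κ) × (α → κ), mon p.1 p.2 = mon I J := ⟨(I, J), rfl⟩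
    simp only [a, dif_pos h]
    obtain ⟨σ, hσ⟩ := exists_perm_comp_eq_of_sum_single_eq (fun t => (h.choose.1 t, h.choose.2 t))
      (fun t => (I t, J t)) h.choose_spec
    rw [← hA σ I J]
    congr 1
    · exact funext fun t => (congrArg Prod.fst (congrFun hσ t)).symm
    · exact funext fun t => (congrArg Prod.snd (congrFun hσ t)).symm
  let L : MvPolynomial (κ × κ) ℂ →ₗ[ℂ] ℂ := (basisMonomials (κ × κ) ℂ).constr ℂ a
  have hL : ∀ I J : α → κ, L (∏ t, X (I t, J t)) = A I J := by
    intro I J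
    rw [prod_X_eq_monomial_sum_single, ← ha]
    have := (basisMonomials (κ × κ) ℂ).constr_basis ℂ a (mon I J)
    rwa [coe_basisMonomials] at this
  ext I K
  have hpoly : ∑ J, C (T I J) * ∏ t, (X (J t, K t) : MvPolynomial (κ × κ) ℂ) =
      ∑ J, C (T J K) * ∏ t, X (I t, J t) := by
    refine eq_of_eval_eq_on_gl fun g => ?_
    have := congrFun (congrFun (hT g g.isUnit) I) K
    simpa [Matrix.mul_apply, tensorPow, eval_prod, mul_comm] using this
  have := congrArg L hpoly
  simp only [← smul_eq_C_mul, map_sum, map_smul, hL, smul_eq_mul] at this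
  simpa only [Matrix.mul_apply, mul_comm] using this

open MvPolynomial in
/-- The product of the traces of words along the cycles of a permutation lies in the algebra
generated by traces of words. -/
theorem sum_prod_word_perm_mem_adjoin (m n : ℕ) (α : Type) [Fintype α] [DecidableEq α]
    (σ : Equiv.Perm α) (w : α → List (Fin n)) (hw : ∀ t, w t ≠ []) :
    ∑ I : α → Fin m, ∏ t, ((w t).map (genMat m n)).prod (I t) (I (σ t)) ∈
      Algebra.adjoin ℂ {p : MvPolynomial (Fin n × Fin m × Fin m) ℂ |
        ∃ w : List (Fin n), w ≠ [] ∧ p = traceWord m n w} := by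
  revert σ w
  refine Fintype.induction_empty_option (P := fun α _ => ∀ [DecidableEq α] (σ : Equiv.Perm α)
    (w : α → List (Fin n)), (∀ t, w t ≠ []) →
      ∑ I : α → Fin m, ∏ t, ((w t).map (genMat m n)).prod (I t) (I (σ t)) ∈
        Algebra.adjoin ℂ {p : MvPolynomial (Fin n × Fin m × Fin m) ℂ |
          ∃ w : List (Fin n), w ≠ [] ∧ p = traceWord m n w}) ?_ ?_ ?_ α
  · intro α β _ e ih _ σ w hw
    classical
    let _ : Fintype α := Fintype.ofEquiv β e.symm
    convert! ih ((e.trans σ).trans e.symm) (w ∘ e) (fun t => hw _) using 1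
    refine (Fintype.sum_equiv (e.arrowCongr (Equiv.refl (Fin m))) _ _ fun I => ?_).symm
    refine Fintype.prod_equiv e _ _ fun t => ?_
    simp
  · intro _ σ w _
    simp
  · intro α _ ih _ σ w hw
    classical
    let W : Option α → Matrix (Fin m) (Fin m) (MvPolynomial (Fin n × Fin m × Fin m) ℂ) :=
      fun t => ((w t).map (genMat m n)).prod
    have hsum : ∑ I : Option α → Fin m, ∏ t, W t (I t) (I (σ t)) =
        ∑ I : α → Fin m, ∑ i : Fin m, W none i ((σ none).elim i I) *
          ∏ t, W (some t) (I t) ((σ (some t)).elim i I) := by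
      rw [Finset.sum_comm, ← Fintype.sum_prod_type']
      refine Fintype.sum_equiv (Equiv.piOptionEquivProd (β := fun _ => Fin m)) _ _ fun I => ?_
      have hI : ∀ o : Option α, o.elim (I none) (fun t => I (some t)) = I o := by
        rintro (_ | _) <;> rfl
      simp [Fintype.prod_option, Equiv.piOptionEquivProd, hI]
    change ∑ I : Option α → Fin m, ∏ t, W t (I t) (I (σ t)) ∈ _
    rw [hsum]
    rcases hs : σ.symm none with _ | s
    · have hnone : σ none = none := (σ.symm_apply_eq.mp hs).symm
      have hsome : ∀ t, σ (some t) = some (σ.removeNone t) := fun t =>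
        (σ.removeNone_some (Option.ne_none_iff_exists'.mp fun h =>
          Option.some_ne_none t (σ.injective (h.trans hnone.symm)))).symm
      simp only [hnone, hsome, Option.elim_none, Option.elim_some, ← Finset.sum_mul,
        ← Finset.mul_sum]
      exact Subalgebra.mul_mem _ (Algebra.subset_adjoin ⟨w none, hw none, rfl⟩)
        (ih σ.removeNone (fun t => w (some t)) fun t => hw _)
    · have hsn : σ (some s) = none := (σ.symm_apply_eq.mp hs).symm
      have hnone : σ none = some (σ.removeNone s) := (σ.removeNone_none hsn).symm
      have hsome : ∀ t, t ≠ s → σ (some t) = some (σ.removeNone t) := fun t ht =>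
        (σ.removeNone_some (Option.ne_none_iff_exists'.mp fun h =>
          ht (Option.some_injective _ (σ.injective (h.trans hsn.symm))))).symm
      convert ih σ.removeNone (fun t => if t = s then w (some s) ++ w none else w (some t))
        (fun t => by split_ifs <;> simp [hw]) using 1
      refine Finset.sum_congr rfl fun I _ => ?_
      rw [← Finset.mul_prod_erase _ _ (Finset.mem_univ s), if_pos rfl, List.map_append,
        List.prod_append, Matrix.mul_apply, Finset.sum_mul]
      refine Finset.sum_congr rfl fun i _ => ?_
      rw [← Finset.mul_prod_erase _ _ (Finset.mem_univ s), hnone, hsn, Option.elim_some,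
        Option.elim_none, mul_left_comm, ← mul_assoc]
      refine congrArg _ (Finset.prod_congr rfl fun t ht => ?_)
      rw [hsome t (Finset.ne_of_mem_erase ht), Option.elim_some, if_neg (Finset.ne_of_mem_erase ht)]

theorem isConjInvariant_of_mem_adjoin (m n : ℕ)
    (f : MvPolynomial (Fin n × Fin m × Fin m) ℂ)
    (hf : f ∈ Algebra.adjoin ℂ
        {p : MvPolynomial (Fin n × Fin m × Fin m) ℂ |
          ∃ w : List (Fin n), w ≠ [] ∧ p = traceWord m n w}) : IsConjInvariant f := by
  intro g hg
  set Φ := MvPolynomial.aeval (R := ℂ)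
      (fun v : Fin n × Fin m × Fin m =>
        (g.map MvPolynomial.C * genMat m n v.1 * g⁻¹.map MvPolynomial.C :
          Matrix (Fin m) (Fin m) (MvPolynomial (Fin n × Fin m × Fin m) ℂ)) v.2.1 v.2.2)
  suffices h : Algebra.adjoin ℂ {p : MvPolynomial (Fin n × Fin m × Fin m) ℂ |
      ∃ w : List (Fin n), w ≠ [] ∧ p = traceWord m n w} ≤ AlgHom.equalizer Φ (AlgHom.id ℂ _) from
    h hf
  refine Algebra.adjoin_le ?_
  rintro _ ⟨w, -, rfl⟩
  have hX : ∀ k, Φ.mapMatrix (genMat m n k) =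
      g.map MvPolynomial.C * genMat m n k * g⁻¹.map MvPolynomial.C := by
    exact fun k => Matrix.ext fun i j => MvPolynomial.aeval_X _ (k, i, j)
  have hinv : (g⁻¹.map MvPolynomial.C : Matrix (Fin m) (Fin m)
      (MvPolynomial (Fin n × Fin m × Fin m) ℂ)) * g.map MvPolynomial.C = 1 := by
    rw [← Matrix.map_mul, Matrix.nonsing_inv_mul _ ((Matrix.isUnit_iff_isUnit_det g).mp hg)]
    exact Matrix.map_one _ (map_zero _) (map_one _)
  have hinv' := mul_eq_one_comm.mp hinv
  have hw : Φ.mapMatrix (w.map (genMat m n)).prod =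
      g.map MvPolynomial.C * (w.map (genMat m n)).prod * g⁻¹.map MvPolynomial.C := by
    induction w with
    | nil => simp [hinv']
    | cons k w ih =>
      rw [List.map_cons, List.prod_cons, map_mul, ih, hX]
      simp only [mul_assoc]
      rw [← mul_assoc (g⁻¹.map MvPolynomial.C) (g.map MvPolynomial.C), hinv, one_mul]
  change Φ (Matrix.trace (w.map (genMat m n)).prod) = Matrix.trace (w.map (genMat m n)).prod
  refine (AddMonoidHom.map_trace Φ _).trans ?_
  change Matrix.trace (Φ.mapMatrix _) = _
  rw [hw, Matrix.trace_mul_comm, ← mul_assoc, hinv, one_mul]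

open MvPolynomial in
theorem mem_adjoin_of_isHomogeneous (m n d : ℕ)
    (f : MvPolynomial (Fin n × Fin m × Fin m) ℂ) (hd : f.IsHomogeneous d)
    (hf : IsConjInvariant f) :
    f ∈ Algebra.adjoin ℂ
        {p : MvPolynomial (Fin n × Fin m × Fin m) ℂ |
          ∃ w : List (Fin n), w ≠ [] ∧ p = traceWord m n w} := by
  obtain ⟨c, hc, rfl⟩ := exists_symmetric_coeff_of_isHomogeneous hd
  let E : (Fin d → Fin n × Fin m × Fin m) ≃ (Fin d → Fin n) × (Fin d → Fin m) × (Fin d → Fin m) :=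
    (Equiv.arrowProdEquivProdArrow _ _ _).trans
      ((Equiv.refl _).prodCongr (Equiv.arrowProdEquivProdArrow _ _ _))
  have hsum : ∀ {A : Type} [AddCommMonoid A] (F : (Fin d → Fin n × Fin m × Fin m) → A),
      ∑ w, F w = ∑ u : Fin d → Fin n, ∑ I : Fin d → Fin m, ∑ J : Fin d → Fin m,
        F fun t => (u t, I t, J t) := by
    intro A _ F
    rw [Fintype.sum_equiv E F (fun p => F fun t => (p.1 t, p.2.1 t, p.2.2 t)) fun _ => rfl]
    simp only [Fintype.sum_prod_type]
  have hinv : ∀ g : Matrix (Fin m) (Fin m) ℂ, IsUnit g → ∀ (u : Fin d → Fin n)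
      (I J : Fin d → Fin m), ∑ I' : Fin d → Fin m, ∑ J' : Fin d → Fin m,
        c (fun t => (u t, I' t, J' t)) * ((∏ t, g (I' t) (I t)) * ∏ t, g⁻¹ (J t) (J' t)) =
          c fun t => (u t, I t, J t) := by
    intro g hg u I J
    let R : Fin n × Fin m × Fin m → Fin n × Fin m × Fin m → ℂ := fun v v' =>
      if v.1 = v'.1 then g v.2.1 v'.2.1 * g⁻¹ v'.2.2 v.2.2 else 0
    have hR : (fun v : Fin n × Fin m × Fin m =>
        (g.map MvPolynomial.C * genMat m n v.1 * g⁻¹.map MvPolynomial.C :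
          Matrix (Fin m) (Fin m) (MvPolynomial (Fin n × Fin m × Fin m) ℂ)) v.2.1 v.2.2) =
        fun v => ∑ v', C (R v v') * X v' := by
      funext v
      simp only [Fintype.sum_prod_type, R, Matrix.mul_apply, Matrix.map_apply, genMat,
        Matrix.of_apply, apply_ite C, ite_mul, map_zero, zero_mul]
      simp only [Finset.sum_ite_irrel, Finset.sum_const_zero, Finset.sum_ite_eq, Finset.mem_univ,
        if_true, Finset.sum_mul, C_mul]
      rw [Finset.sum_comm]
      exact Finset.sum_congr rfl fun _ _ => Finset.sum_congr rfl fun _ _ => by ring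
    have h := hf g hg
    rw [hR, aeval_linear_sum_prod_X] at h
    have h' := congrFun (eq_of_symmetric_of_sum_eq (fun σ w => ?_) hc h) fun t => (u t, I t, J t)
    · rw [← h', hsum]
      simp only [R, Finset.prod_ite_zero, Finset.mem_univ, true_implies, mul_ite, mul_zero,
        Finset.prod_mul_distrib]
      have hfun : ∀ u' : Fin d → Fin n, (∀ t, u' t = u t) ↔ u' = u := fun _ => funext_iff.symm
      simp only [hfun, Finset.sum_ite_irrel, Finset.sum_const_zero, Finset.sum_ite_eq', Finset.mem_univ,
        if_true]
    · rw [← Equiv.sum_comp (σ.symm.arrowCongr (Equiv.refl _))]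
      refine Finset.sum_congr rfl fun w' _ => ?_
      congr 1
      · exact hc σ w'
      · exact Equiv.prod_comp σ fun t => R (w' t) (w t)
  have hperm : ∀ u : Fin d → Fin n, ∃ a : Equiv.Perm (Fin d) → ℂ, ∀ I J : Fin d → Fin m,
      c (fun t => (u t, I t, J t)) =
        ∑ σ : Equiv.Perm (Fin d), a σ * if I ∘ σ = J then 1 else 0 := by
    intro u
    let M : Matrix (Fin d → Fin m) (Fin d → Fin m) ℂ := Matrix.of fun I J =>
      c fun t => (u t, I t, J t)
    refine exists_eq_sum_perm_of_commute M (commute_of_commute_tensorPow M fun g hg => ?_)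
    have hdet := (Matrix.isUnit_iff_isUnit_det g).mp hg
    have hM : tensorPow (Fin d) g * M * tensorPow (Fin d) g⁻¹ = M := by
      ext I J
      refine Eq.trans ?_ (hinv g.transpose (g.isUnit_transpose.mpr hg) u I J)
      rw [← Matrix.transpose_nonsing_inv]
      simp only [Matrix.mul_apply, tensorPow, Matrix.of_apply, M, Finset.sum_mul,
        Matrix.transpose_apply]
      rw [Finset.sum_comm]
      exact Finset.sum_congr rfl fun _ _ => Finset.sum_congr rfl fun _ _ => by ring
    conv_lhs => rw [← hM]
    rw [mul_assoc, ← tensorPow_mul, Matrix.nonsing_inv_mul _ hdet, tensorPow_one, mul_one]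
  choose a ha using hperm
  rw [hsum]
  refine Subalgebra.sum_mem _ fun u _ => ?_
  have hu : ∑ I : Fin d → Fin m, ∑ J : Fin d → Fin m, C (c fun t => (u t, I t, J t)) *
      ∏ t, (X (u t, I t, J t) : MvPolynomial (Fin n × Fin m × Fin m) ℂ) =
      ∑ σ : Equiv.Perm (Fin d), a u σ • ∑ I : Fin d → Fin m,
        ∏ t, (([u t].map (genMat m n)).prod) (I t) (I (σ t)) := by
    simp only [Finset.smul_sum]
    conv_rhs => rw [Finset.sum_comm]
    refine Finset.sum_congr rfl fun I _ => ?_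
    simp only [ha, map_sum, Finset.sum_mul]
    rw [Finset.sum_comm]
    refine Finset.sum_congr rfl fun σ _ => ?_
    rw [Finset.sum_eq_single (I ∘ σ)]
    · simp [genMat, smul_eq_C_mul]
    · intro J _ hJ
      simp [hJ.symm]
    · simp
  rw [hu]
  exact Subalgebra.sum_mem _ fun σ _ => Subalgebra.smul_mem _
    (sum_prod_word_perm_mem_adjoin m n (Fin d) σ (fun t => [u t]) fun t => by simp) _

open MvPolynomial in
theorem isConjInvariant_homogeneousComponent {m n : ℕ}
    {f : MvPolynomial (Fin n × Fin m × Fin m) ℂ} (hf : IsConjInvariant f) (d : ℕ) :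
    IsConjInvariant (homogeneousComponent d f) := by
  intro g hg
  have hlin : ∀ v : Fin n × Fin m × Fin m, ((g.map C * genMat m n v.1 * g⁻¹.map C :
      Matrix (Fin m) (Fin m) (MvPolynomial (Fin n × Fin m × Fin m) ℂ))
        v.2.1 v.2.2).IsHomogeneous 1 := by
    intro v
    simp only [Matrix.mul_apply, Matrix.map_apply, genMat, Matrix.of_apply]
    refine IsHomogeneous.sum _ _ _ fun j _ => ?_
    refine (IsHomogeneous.sum _ _ 1 fun i _ => ?_).mul (isHomogeneous_C _ _)
    simpa using (isHomogeneous_C _ _).mul (isHomogeneous_X ℂ (v.1, i, j))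
  set Φ := aeval (R := ℂ) fun v : Fin n × Fin m × Fin m =>
    (g.map C * genMat m n v.1 * g⁻¹.map C :
      Matrix (Fin m) (Fin m) (MvPolynomial (Fin n × Fin m × Fin m) ℂ)) v.2.1 v.2.2
  have hΦ : ∀ e, (Φ (homogeneousComponent e f)).IsHomogeneous e := fun e => by
    have := (homogeneousComponent_isHomogeneous e f).aeval _ hlin
    rwa [one_mul] at this
  have h := congrArg (homogeneousComponent d) (hf g hg)
  change homogeneousComponent d (Φ f) = _ at h
  nth_rewrite 1 [← sum_homogeneousComponent f] at h
  rw [map_sum, map_sum] at h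
  simp only [homogeneousComponent_of_mem (hΦ _)] at h
  rw [Finset.sum_ite_eq] at h
  split_ifs at h with hd
  · exact h
  · rw [← h, map_zero]

/-- **First fundamental theorem of matrix invariants**: the invariant ring
`R_{m,n} = ℂ[X₁,…,Xₙ]^{GLₘ}` is generated as a ℂ-algebra by the traces
`Tr(X_{i₁} ⋯ X_{i_k})` of (nonempty) words in the generic matrices. -/
theorem invariantRing_eq_adjoin_traceWords (m n : ℕ) (hm : 0 < m) (hn : 0 < n)
    (f : MvPolynomial (Fin n × Fin m × Fin m) ℂ) :
    IsConjInvariant f ↔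
      f ∈ Algebra.adjoin ℂ
        {p : MvPolynomial (Fin n × Fin m × Fin m) ℂ |
          ∃ w : List (Fin n), w ≠ [] ∧ p = traceWord m n w} := by
  refine ⟨fun hf => ?_, isConjInvariant_of_mem_adjoin m n f⟩
  rw [← MvPolynomial.sum_homogeneousComponent f]
  exact Subalgebra.sum_mem _ fun d _ => mem_adjoin_of_isHomogeneous m n d _
    (MvPolynomial.homogeneousComponent_isHomogeneous d f)
    (isConjInvariant_homogeneousComponent hf d)
end

section
/- Define h(d₁,d₂) as the dimension of the space of bihomogeneous elements of bidegree (d₁,d₂) of the ring of two generic 2×2 matrices, i.e. the dimension of the quotient of the span of monomials in ℂ⟨x₁,x₂⟩ containing x₁ exactly d₁ times and x₂ exactly d₂ times, modulo the subspace of polynomial identities of 2×2 matrices of that bidegree. Then the formal power series H(t₁,t₂) = Σ_{(d₁,d₂) ∈ ℕ²} h(d₁,d₂) t₁^{d₁} t₂^{d₂} satisfies (1−t₁)²(1−t₂)²(1−t₁t₂)·H(t₁,t₂) = 1 − t₁ − t₂ + t₁t₂ + t₁²t₂ + t₁t₂² − t₁²t₂² (Formanek's formula for the Hilbert series of the ring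 of two generic 2×2 matrices). -/
/-- The monomial `x_{i₁} ⋯ x_{i_k}` of the free algebra `ℂ⟨x₁,x₂⟩` associated to the
word `w = (i₁, …, i_k)`. -/
noncomputable def freeMonomial (w : List (Fin 2)) : FreeAlgebra ℂ (Fin 2) :=
  (w.map (FreeAlgebra.ι ℂ)).prod

/-- The subspace of `ℂ⟨x₁,x₂⟩` of polynomial identities of `2 × 2` matrices. -/
noncomputable def piSpace : Submodule ℂ (FreeAlgebra ℂ (Fin 2)) where
  carrier := {f | ∀ A : Fin 2 → Matrix (Fin 2) (Fin 2) ℂ, FreeAlgebra.lift ℂ A f = 0}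
  add_mem' := by
    intro a b ha hb A
    simp only [Set.mem_setOf_eq] at ha hb
    simp [map_add, ha A, hb A]
  zero_mem' := by
    intro A
    simp
  smul_mem' := by
    intro c a ha A
    simp only [Set.mem_setOf_eq] at ha
    simp [map_smul, ha A]

/-- The span of the monomials of `ℂ⟨x₁,x₂⟩` containing `x₁` exactly `d₁` times and
`x₂` exactly `d₂` times. -/
noncomputable def bidegSpan (d₁ d₂ : ℕ) : Submodule ℂ (FreeAlgebra ℂ (Fin 2)) :=
  Submodule.span ℂ
    {x | ∃ w : List (Fin 2), w.count 0 = d₁ ∧ w.count 1 = d₂ ∧ x = freeMonomial w}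

/-- `h d₁ d₂`: the dimension of the bidegree-`(d₁,d₂)` component of the ring of two
generic `2 × 2` matrices, i.e. of the quotient of the span of bidegree-`(d₁,d₂)`
monomials modulo the polynomial identities of `2 × 2` matrices of that bidegree. -/
noncomputable def hCoeff (d₁ d₂ : ℕ) : ℕ :=
  Module.finrank ℂ
    (↥(bidegSpan d₁ d₂) ⧸ Submodule.comap (bidegSpan d₁ d₂).subtype piSpace)

/-- The Hilbert series `H(t₁,t₂) = Σ h(d₁,d₂) t₁^{d₁} t₂^{d₂}` of the ring of two
generic `2 × 2` matrices, as a formal power series in two commuting variables. -/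
noncomputable def hilbertSeries : MvPowerSeries (Fin 2) ℂ :=
  fun e => (hCoeff (e 0) (e 1) : ℂ)

open Finset

section GenericPair

variable {E : Type*} [Ring E] [Algebra ℂ E]

/-- The relations satisfied by two `2 × 2` matrices `x`, `y`, their adjugates `x'`, `y'`
and the scalar matrix `s = tr(xy)` that are used to straighten words in `x` and `y`. -/
structure IsQuaternionicPair (x x' y y' s : E) : Prop where
  comm_left : Commute x x'
  comm_right : Commute y y'
  trace_left (z : E) : Commute (x + x') z
  trace_right (z : E) : Commute (y + y') z
  trace_mul (z : E) : Commute s z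
  swap : y * x = s - x' * y'
  commutator_left : (x * y - y * x) * x = x' * (x * y - y * x)
  commutator_right : (x * y - y * x) * y = y' * (x * y - y * x)

/-- The value of the word `w` at the pair `(x, y)`. -/
def wordEval (x y : E) (w : List (Fin 2)) : E := (w.map ![x, y]).prod

/-- The span of the values at `(x, y)` of the words of bidegree `(d₁, d₂)`. -/
def wordSpan (x y : E) (d₁ d₂ : ℕ) : Submodule ℂ E :=
  Submodule.span ℂ {z | ∃ w : List (Fin 2), w.count 0 = d₁ ∧ w.count 1 = d₂ ∧ z = wordEval x y w}

/-- The normal form `s^e x^i x'^k y^j y'^l [x, y]`. -/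
def normalForm (x x' y y' s : E) (e i k j l : ℕ) : E :=
  s ^ e * (x ^ i * x' ^ k) * (y ^ j * y' ^ l) * (x * y - y * x)

/-- The span of the normal forms of bidegree `(d₁, d₂)`. -/
def normalSpan (x x' y y' s : E) (d₁ d₂ : ℕ) : Submodule ℂ E :=
  Submodule.span ℂ {z | ∃ e i k j l : ℕ, e + i + k + 1 = d₁ ∧ e + j + l + 1 = d₂ ∧
    z = normalForm x x' y y' s e i k j l}

/-- The span of the elements `u [x, y] v` of bidegree `(d₁, d₂)`, with `u`, `v` words. -/
def commutatorSpan (x y : E) (d₁ d₂ : ℕ) : Submodule ℂ E :=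
  Submodule.span ℂ {z | ∃ u v : List (Fin 2), u.count 0 + v.count 0 + 1 = d₁ ∧
    u.count 1 + v.count 1 + 1 = d₂ ∧ z = wordEval x y u * (x * y - y * x) * wordEval x y v}

lemma mul_mem_of_mem_span {S : Set E} {N : Submodule ℂ E} (a : E) (h : ∀ z ∈ S, a * z ∈ N)
    {z : E} (hz : z ∈ Submodule.span ℂ S) : a * z ∈ N :=
  (Submodule.span_le (p := N.comap (LinearMap.mulLeft ℂ a))).2 h hz

omit [Algebra ℂ E] in
lemma wordEval_nil (x y : E) : wordEval x y [] = 1 := by simp [wordEval]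

omit [Algebra ℂ E] in
lemma wordEval_cons (x y : E) (a : Fin 2) (w : List (Fin 2)) :
    wordEval x y (a :: w) = ![x, y] a * wordEval x y w := by simp [wordEval]

omit [Algebra ℂ E] in
lemma wordEval_append (x y : E) (u v : List (Fin 2)) :
    wordEval x y (u ++ v) = wordEval x y u * wordEval x y v := by simp [wordEval]

lemma commutatorSpan_le_wordSpan (x y : E) (d₁ d₂ : ℕ) :
    commutatorSpan x y d₁ d₂ ≤ wordSpan x y d₁ d₂ := by
  refine Submodule.span_le.2 ?_
  rintro _ ⟨u, v, h₁, h₂, rfl⟩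
  have h : wordEval x y u * (x * y - y * x) * wordEval x y v =
      wordEval x y (u ++ 0 :: 1 :: v) - wordEval x y (u ++ 1 :: 0 :: v) := by
    simp only [wordEval_append, wordEval_cons, Matrix.cons_val_zero, Matrix.cons_val_one]
    noncomm_ring
  rw [SetLike.mem_coe, h]
  refine sub_mem (Submodule.subset_span ⟨_, ?_, ?_, rfl⟩) (Submodule.subset_span ⟨_, ?_, ?_, rfl⟩)
    <;> simp <;> omega

lemma mul_mem_commutatorSpan_left (x y : E) {d₁ d₂ : ℕ} {z : E}
    (hz : z ∈ commutatorSpan x y d₁ d₂) : x * z ∈ commutatorSpan x y (d₁ + 1) d₂ := by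
  refine mul_mem_of_mem_span x ?_ hz
  rintro _ ⟨u, v, h₁, h₂, rfl⟩
  refine Submodule.subset_span ⟨0 :: u, v, ?_, ?_, ?_⟩
  · simp; omega
  · simp; omega
  · simp [wordEval_cons, mul_assoc]

lemma mul_mem_commutatorSpan_right (x y : E) {d₁ d₂ : ℕ} {z : E}
    (hz : z ∈ commutatorSpan x y d₁ d₂) : y * z ∈ commutatorSpan x y d₁ (d₂ + 1) := by
  refine mul_mem_of_mem_span y ?_ hz
  rintro _ ⟨u, v, h₁, h₂, rfl⟩
  refine Submodule.subset_span ⟨1 :: u, v, ?_, ?_, ?_⟩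
  · simp; omega
  · simp; omega
  · simp [wordEval_cons, mul_assoc]

namespace IsQuaternionicPair

variable {x x' y y' s : E} (h : IsQuaternionicPair x x' y y' s)
include h

lemma adjugate_left_mul_mem_commutatorSpan {d₁ d₂ : ℕ} {z : E}
    (hz : z ∈ commutatorSpan x y d₁ d₂) : x' * z ∈ commutatorSpan x y (d₁ + 1) d₂ := by
  refine mul_mem_of_mem_span x' ?_ hz
  rintro _ ⟨u, v, h₁, h₂, rfl⟩
  set c := x * y - y * x with hc
  have key : x' * (wordEval x y u * c * wordEval x y v) =
      wordEval x y (u ++ [0]) * c * wordEval x y v + wordEval x y u * c * wordEval x y (0 :: v)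
        - wordEval x y (0 :: u) * c * wordEval x y v := by
    have ht := (h.trace_left (wordEval x y u)).eq
    have hx : c * x = x' * c := h.commutator_left
    simp only [wordEval_append, wordEval_cons, wordEval_nil, Matrix.cons_val_zero, mul_one]
    linear_combination (norm := noncomm_ring) ht * c * wordEval x y v
      - wordEval x y u * hx * wordEval x y v
  rw [key]
  refine sub_mem (add_mem (Submodule.subset_span ⟨_, _, ?_, ?_, rfl⟩)
    (Submodule.subset_span ⟨_, _, ?_, ?_, rfl⟩)) (Submodule.subset_span ⟨_, _, ?_, ?_, rfl⟩)
    <;> simp <;> omega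

lemma adjugate_right_mul_mem_commutatorSpan {d₁ d₂ : ℕ} {z : E}
    (hz : z ∈ commutatorSpan x y d₁ d₂) : y' * z ∈ commutatorSpan x y d₁ (d₂ + 1) := by
  refine mul_mem_of_mem_span y' ?_ hz
  rintro _ ⟨u, v, h₁, h₂, rfl⟩
  set c := x * y - y * x with hc
  have key : y' * (wordEval x y u * c * wordEval x y v) =
      wordEval x y (u ++ [1]) * c * wordEval x y v + wordEval x y u * c * wordEval x y (1 :: v)
        - wordEval x y (1 :: u) * c * wordEval x y v := by
    have ht := (h.trace_right (wordEval x y u)).eq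
    have hy : c * y = y' * c := h.commutator_right
    simp only [wordEval_append, wordEval_cons, wordEval_nil, Matrix.cons_val_one,
      Matrix.cons_val_fin_one, mul_one]
    linear_combination (norm := noncomm_ring) ht * c * wordEval x y v
      - wordEval x y u * hy * wordEval x y v
  rw [key]
  refine sub_mem (add_mem (Submodule.subset_span ⟨_, _, ?_, ?_, rfl⟩)
    (Submodule.subset_span ⟨_, _, ?_, ?_, rfl⟩)) (Submodule.subset_span ⟨_, _, ?_, ?_, rfl⟩)
    <;> simp <;> omega

lemma normalForm_mem_commutatorSpan (e i k j l : ℕ) :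
    normalForm x x' y y' s e i k j l ∈ commutatorSpan x y (e + i + k + 1) (e + j + l + 1) := by
  have hs : s = y * x + x' * y' := by rw [h.swap]; abel
  have hl : y' ^ l * (x * y - y * x) ∈ commutatorSpan x y 1 (l + 1) := by
    induction l with
    | zero => exact Submodule.subset_span ⟨[], [], by simp, by simp, by simp [wordEval_nil]⟩
    | succ l ih => rw [pow_succ', mul_assoc]; exact h.adjugate_right_mul_mem_commutatorSpan ih
  have hj : y ^ j * (y' ^ l * (x * y - y * x)) ∈ commutatorSpan x y 1 (j + l + 1) := by
    induction j with
    | zero => simpa using hl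
    | succ j ih =>
      rw [pow_succ', mul_assoc, show j + 1 + l + 1 = j + l + 1 + 1 by ring]
      exact mul_mem_commutatorSpan_right x y ih
  have hk : x' ^ k * (y ^ j * (y' ^ l * (x * y - y * x))) ∈
      commutatorSpan x y (k + 1) (j + l + 1) := by
    induction k with
    | zero => simpa using hj
    | succ k ih => rw [pow_succ', mul_assoc]; exact h.adjugate_left_mul_mem_commutatorSpan ih
  have hi : x ^ i * (x' ^ k * (y ^ j * (y' ^ l * (x * y - y * x)))) ∈
      commutatorSpan x y (i + k + 1) (j + l + 1) := by
    induction i with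
    | zero => simpa using hk
    | succ i ih =>
      rw [pow_succ', mul_assoc, show i + 1 + k + 1 = i + k + 1 + 1 by ring]
      exact mul_mem_commutatorSpan_left x y ih
  have he : s ^ e * (x ^ i * (x' ^ k * (y ^ j * (y' ^ l * (x * y - y * x))))) ∈
      commutatorSpan x y (e + i + k + 1) (e + j + l + 1) := by
    induction e with
    | zero => simpa using hi
    | succ e ih =>
      rw [pow_succ', mul_assoc, show e + 1 + i + k + 1 = e + i + k + 1 + 1 by ring,
        show e + 1 + j + l + 1 = e + j + l + 1 + 1 by ring]
      generalize s ^ e * _ = z at ih ⊢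
      rw [hs, add_mul, mul_assoc, mul_assoc]
      exact add_mem (mul_mem_commutatorSpan_right x y (mul_mem_commutatorSpan_left x y ih))
        (h.adjugate_left_mul_mem_commutatorSpan (h.adjugate_right_mul_mem_commutatorSpan ih))
  simpa only [normalForm, mul_assoc] using he

lemma normalSpan_le_wordSpan (d₁ d₂ : ℕ) :
    normalSpan x x' y y' s d₁ d₂ ≤ wordSpan x y d₁ d₂ := by
  refine (Submodule.span_le.2 ?_).trans (commutatorSpan_le_wordSpan x y d₁ d₂)
  rintro _ ⟨e, i, k, j, l, rfl, rfl, rfl⟩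
  exact h.normalForm_mem_commutatorSpan e i k j l

omit h in
lemma normalForm_mem_normalSpan {e i k j l d₁ d₂ : ℕ} (h₁ : e + i + k + 1 = d₁)
    (h₂ : e + j + l + 1 = d₂) :
    normalForm x x' y y' s e i k j l ∈ normalSpan x x' y y' s d₁ d₂ :=
  Submodule.subset_span ⟨e, i, k, j, l, h₁, h₂, rfl⟩

omit [Algebra ℂ E] in
lemma left_mul_normalForm (e i k j l : ℕ) :
    x * normalForm x x' y y' s e i k j l = normalForm x x' y y' s e (i + 1) k j l := by
  have hs := ((h.trace_mul x).pow_left e).eq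
  simp only [normalForm, pow_succ' x]
  linear_combination (norm := noncomm_ring)
    -hs * (x ^ i * x' ^ k) * (y ^ j * y' ^ l) * (x * y - y * x)

omit [Algebra ℂ E] in
lemma adjugate_left_mul_normalForm (e i k j l : ℕ) :
    x' * normalForm x x' y y' s e i k j l = normalForm x x' y y' s e i (k + 1) j l := by
  have hs := ((h.trace_mul x').pow_left e).eq
  have hx := (h.comm_left.pow_left i).eq
  simp only [normalForm, pow_succ' x']
  linear_combination (norm := noncomm_ring)
    (-hs * x ^ i - s ^ e * hx) * x' ^ k * (y ^ j * y' ^ l) * (x * y - y * x)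

omit [Algebra ℂ E] h in
lemma trace_mul_normalForm (e i k j l : ℕ) :
    s * normalForm x x' y y' s e i k j l = normalForm x x' y y' s (e + 1) i k j l := by
  simp only [normalForm, pow_succ' s, mul_assoc]

omit [Algebra ℂ E] in
lemma trace_right_mul_normalForm (e i k j l : ℕ) :
    (y + y') * normalForm x x' y y' s e i k j l =
      normalForm x x' y y' s e i k (j + 1) l + normalForm x x' y y' s e i k j (l + 1) := by
  have ht := (h.trace_right (s ^ e * (x ^ i * x' ^ k))).eq
  have hy := (h.comm_right.pow_left j).eq
  simp only [normalForm, pow_succ' y, pow_succ' y']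
  linear_combination (norm := noncomm_ring)
    (ht * y ^ j - s ^ e * (x ^ i * x' ^ k) * hy) * y' ^ l * (x * y - y * x)

lemma left_mul_mem_normalSpan {d₁ d₂ : ℕ} {z : E} (hz : z ∈ normalSpan x x' y y' s d₁ d₂) :
    x * z ∈ normalSpan x x' y y' s (d₁ + 1) d₂ := by
  refine mul_mem_of_mem_span x ?_ hz
  rintro _ ⟨e, i, k, j, l, rfl, rfl, rfl⟩
  rw [h.left_mul_normalForm]
  exact normalForm_mem_normalSpan (by ring) rfl

lemma adjugate_left_mul_mem_normalSpan {d₁ d₂ : ℕ} {z : E}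
    (hz : z ∈ normalSpan x x' y y' s d₁ d₂) : x' * z ∈ normalSpan x x' y y' s (d₁ + 1) d₂ := by
  refine mul_mem_of_mem_span x' ?_ hz
  rintro _ ⟨e, i, k, j, l, rfl, rfl, rfl⟩
  rw [h.adjugate_left_mul_normalForm]
  exact normalForm_mem_normalSpan (by ring) rfl

lemma right_mul_normalForm_mem_normalSpan (e i k j l : ℕ) :
    y * normalForm x x' y y' s e i k j l ∈
      normalSpan x x' y y' s (e + i + k + 1) (e + j + l + 1 + 1) := by
  have step (e i k j l : ℕ) (ih : y * normalForm x x' y y' s e i k j l ∈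
      normalSpan x x' y y' s (e + i + k + 1) (e + j + l + 1 + 1)) :
      y * (x * normalForm x x' y y' s e i k j l) ∈
        normalSpan x x' y y' s (e + i + k + 1 + 1) (e + j + l + 1 + 1) := by
    have h₁ : y * (x * normalForm x x' y y' s e i k j l) =
        s * normalForm x x' y y' s e i k j l - x' * ((y + y') * normalForm x x' y y' s e i k j l
          - y * normalForm x x' y y' s e i k j l) := by
      linear_combination (norm := noncomm_ring) h.swap * normalForm x x' y y' s e i k j l
    rw [h₁, trace_mul_normalForm, h.trace_right_mul_normalForm]
    refine sub_mem (normalForm_mem_normalSpan (by ring) (by ring))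
      (h.adjugate_left_mul_mem_normalSpan (sub_mem (add_mem ?_ ?_) ih))
    · exact normalForm_mem_normalSpan (by ring) (by ring)
    · exact normalForm_mem_normalSpan (by ring) (by ring)
  induction i with
  | zero =>
    induction k with
    | zero =>
      have h₁ : y * normalForm x x' y y' s e 0 0 j l = normalForm x x' y y' s e 0 0 (j + 1) l := by
        have hs := ((h.trace_mul y).pow_left e).eq
        simp only [normalForm, pow_succ' y, pow_zero]
        linear_combination (norm := noncomm_ring) -hs * (y ^ j * y' ^ l) * (x * y - y * x)
      rw [h₁]
      exact normalForm_mem_normalSpan (by ring) (by ring)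
    | succ k ih =>
      have h₁ : y * normalForm x x' y y' s e 0 (k + 1) j l =
          x * (y * normalForm x x' y y' s e 0 k j l) + x' * (y * normalForm x x' y y' s e 0 k j l)
            - y * (x * normalForm x x' y y' s e 0 k j l) := by
        rw [← h.adjugate_left_mul_normalForm]
        linear_combination (norm := noncomm_ring)
          -(h.trace_left y).eq * normalForm x x' y y' s e 0 k j l
      rw [h₁]
      exact sub_mem (add_mem (h.left_mul_mem_normalSpan ih)
        (h.adjugate_left_mul_mem_normalSpan ih)) (step _ _ _ _ _ ih)
  | succ i ih =>
    rw [← h.left_mul_normalForm, show e + (i + 1) + k + 1 = e + i + k + 1 + 1 by ring]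
    exact step _ _ _ _ _ ih

lemma right_mul_mem_normalSpan {d₁ d₂ : ℕ} {z : E} (hz : z ∈ normalSpan x x' y y' s d₁ d₂) :
    y * z ∈ normalSpan x x' y y' s d₁ (d₂ + 1) := by
  refine mul_mem_of_mem_span y ?_ hz
  rintro _ ⟨e, i, k, j, l, rfl, rfl, rfl⟩
  exact h.right_mul_normalForm_mem_normalSpan e i k j l

omit [Algebra ℂ E] in
lemma commutator_mul_pow (i j : ℕ) :
    (x * y - y * x) * (x ^ i * y ^ j) = x' ^ i * y' ^ j * (x * y - y * x) := by
  have hx : SemiconjBy (x * y - y * x) x x' := h.commutator_left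
  have hy : SemiconjBy (x * y - y * x) y y' := h.commutator_right
  exact ((hx.pow_right i).mul_right (hy.pow_right j)).eq

lemma right_mul_pow_sub_mem_normalSpan (i j : ℕ) :
    y * (x ^ i * y ^ j) - x ^ i * y ^ (j + 1) ∈ normalSpan x x' y y' s i (j + 1) := by
  induction i with
  | zero => simp [pow_succ']
  | succ i ih =>
    have h₁ : y * (x ^ (i + 1) * y ^ j) - x ^ (i + 1) * y ^ (j + 1) =
        x * (y * (x ^ i * y ^ j) - x ^ i * y ^ (j + 1)) - normalForm x x' y y' s 0 0 i 0 j := by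
      have hc := h.commutator_mul_pow i j
      simp only [normalForm, pow_succ' x, pow_zero, one_mul]
      linear_combination (norm := noncomm_ring) -hc
    rw [h₁]
    exact sub_mem (h.left_mul_mem_normalSpan ih) (normalForm_mem_normalSpan (by ring) (by ring))

lemma wordSpan_eq (d₁ d₂ : ℕ) :
    wordSpan x y d₁ d₂ = Submodule.span ℂ {x ^ d₁ * y ^ d₂} ⊔ normalSpan x x' y y' s d₁ d₂ := by
  apply le_antisymm
  · refine Submodule.span_le.2 ?_
    rintro _ ⟨w, rfl, rfl, rfl⟩
    rw [SetLike.mem_coe]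
    induction w with
    | nil => exact Submodule.mem_sup_left (by simp [wordEval_nil])
    | cons a w ih =>
      obtain ⟨p, hp, q, hq, hpq⟩ := Submodule.mem_sup.1 ih
      obtain ⟨r, rfl⟩ := Submodule.mem_span_singleton.1 hp
      rw [wordEval_cons, ← hpq]
      match a with
      | 0 =>
        simp only [Matrix.cons_val_zero, mul_add, List.count_cons_self, mul_smul_comm]
        rw [List.count_cons_of_ne (by decide)]
        refine Submodule.add_mem_sup (Submodule.smul_mem _ _ ?_) (h.left_mul_mem_normalSpan hq)
        rw [← mul_assoc, ← pow_succ']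
        exact Submodule.mem_span_singleton_self _
      | 1 =>
        simp only [Matrix.cons_val_one, mul_add, List.count_cons_self, mul_smul_comm]
        rw [List.count_cons_of_ne (by decide)]
        have h₁ := h.right_mul_pow_sub_mem_normalSpan (w.count 0) (w.count 1)
        refine add_mem (Submodule.smul_mem _ _ ?_)
          (Submodule.mem_sup_right (h.right_mul_mem_normalSpan hq))
        have h₂ := Submodule.add_mem_sup
          (Submodule.mem_span_singleton_self (R := ℂ) (x ^ w.count 0 * y ^ (w.count 1 + 1))) h₁
        simpa using h₂
  · refine sup_le ((Submodule.span_singleton_le_iff_mem _ _).2 (Submodule.subset_span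
      ⟨List.replicate d₁ 0 ++ List.replicate d₂ 1, ?_, ?_, ?_⟩)) (h.normalSpan_le_wordSpan d₁ d₂)
    · simp [List.count_replicate]
    · simp [List.count_replicate]
    · simp [wordEval]

end IsQuaternionicPair

end GenericPair

section Matrices

open Matrix

lemma isQuaternionicPair_matrix (M N : Matrix (Fin 2) (Fin 2) ℂ) :
    IsQuaternionicPair M M.adjugate N N.adjugate ((M * N).trace • 1) where
  comm_left := by simp [commute_iff_eq, mul_adjugate, adjugate_mul]
  comm_right := by simp [commute_iff_eq, mul_adjugate, adjugate_mul]
  trace_left z := by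
    ext i j
    fin_cases i <;> fin_cases j <;> simp [adjugate_fin_two, mul_apply] <;> ring
  trace_right z := by
    ext i j
    fin_cases i <;> fin_cases j <;> simp [adjugate_fin_two, mul_apply] <;> ring
  trace_mul z := by simp [commute_iff_eq]
  swap := by
    ext i j
    fin_cases i <;> fin_cases j <;> simp [adjugate_fin_two, mul_apply, trace_fin_two] <;> ring
  commutator_left := by
    ext i j
    fin_cases i <;> fin_cases j <;> simp [adjugate_fin_two, mul_apply] <;> ring
  commutator_right := by
    ext i j
    fin_cases i <;> fin_cases j <;> simp [adjugate_fin_two, mul_apply] <;> ring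

/-- The algebra of matrix-valued functions of a pair of `2 × 2` matrices. -/
abbrev PairFunction : Type :=
  (Fin 2 → Matrix (Fin 2) (Fin 2) ℂ) → Matrix (Fin 2) (Fin 2) ℂ

/-- The generic matrix `A ↦ A i`. -/
def genericMatrix (i : Fin 2) : PairFunction := fun A => A i

/-- The adjugate of a generic matrix. -/
noncomputable def genericAdjugate (i : Fin 2) : PairFunction := fun A => (A i).adjugate

/-- The trace of the product of the two generic matrices, as a scalar matrix. -/
noncomputable def genericTrace : PairFunction := fun A => (A 0 * A 1).trace • 1

lemma isQuaternionicPair_generic :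
    IsQuaternionicPair (genericMatrix 0) (genericAdjugate 0) (genericMatrix 1) (genericAdjugate 1)
      genericTrace where
  comm_left := funext fun A => (isQuaternionicPair_matrix (A 0) (A 1)).comm_left
  comm_right := funext fun A => (isQuaternionicPair_matrix (A 0) (A 1)).comm_right
  trace_left z := funext fun A => (isQuaternionicPair_matrix (A 0) (A 1)).trace_left (z A)
  trace_right z := funext fun A => (isQuaternionicPair_matrix (A 0) (A 1)).trace_right (z A)
  trace_mul z := funext fun A => (isQuaternionicPair_matrix (A 0) (A 1)).trace_mul (z A)
  swap := funext fun A => (isQuaternionicPair_matrix (A 0) (A 1)).swap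
  commutator_left := funext fun A => (isQuaternionicPair_matrix (A 0) (A 1)).commutator_left
  commutator_right := funext fun A => (isQuaternionicPair_matrix (A 0) (A 1)).commutator_right

/-- Evaluation of noncommutative polynomials at the two generic matrices. -/
noncomputable def genericEval : FreeAlgebra ℂ (Fin 2) →ₐ[ℂ] PairFunction :=
  FreeAlgebra.lift ℂ genericMatrix

lemma genericEval_apply (f : FreeAlgebra ℂ (Fin 2)) (A : Fin 2 → Matrix (Fin 2) (Fin 2) ℂ) :
    genericEval f A = FreeAlgebra.lift ℂ A f := by
  have h : (Pi.evalAlgHom ℂ (fun _ : Fin 2 → Matrix (Fin 2) (Fin 2) ℂ =>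
      Matrix (Fin 2) (Fin 2) ℂ) A).comp genericEval = FreeAlgebra.lift ℂ A := by
    ext1
    funext i
    simp [genericEval, genericMatrix]
  exact DFunLike.congr_fun h f

lemma ker_genericEval : LinearMap.ker genericEval.toLinearMap = piSpace := by
  ext f
  rw [LinearMap.mem_ker, AlgHom.toLinearMap_apply, funext_iff]
  exact forall_congr' fun A => by rw [genericEval_apply]; rfl

lemma map_genericEval_bidegSpan (d₁ d₂ : ℕ) :
    (bidegSpan d₁ d₂).map genericEval.toLinearMap =
      wordSpan (genericMatrix 0) (genericMatrix 1) d₁ d₂ := by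
  have hw (w : List (Fin 2)) :
      genericEval (freeMonomial w) = wordEval (genericMatrix 0) (genericMatrix 1) w := by
    rw [freeMonomial, wordEval, map_list_prod, List.map_map]
    congr 2
    funext i
    fin_cases i <;> simp [genericEval]
  rw [bidegSpan, wordSpan, Submodule.map_span]
  congr 1
  ext z
  constructor
  · rintro ⟨_, ⟨w, h₁, h₂, rfl⟩, rfl⟩
    exact ⟨w, h₁, h₂, hw w⟩
  · rintro ⟨w, h₁, h₂, rfl⟩
    exact ⟨_, ⟨w, h₁, h₂, rfl⟩, hw w⟩

lemma hCoeff_eq_finrank_wordSpan (d₁ d₂ : ℕ) :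
    hCoeff d₁ d₂ = Module.finrank ℂ (wordSpan (genericMatrix 0) (genericMatrix 1) d₁ d₂) := by
  rw [hCoeff, ← ker_genericEval, ← map_genericEval_bidegSpan, ← LinearMap.range_domRestrict,
    ← LinearMap.ker_domRestrict]
  exact (LinearMap.quotKerEquivRange _).finrank_eq

/-- The normal forms of the two generic matrices. -/
noncomputable def genericNormalForm (a : (_ : ℕ) × (ℕ × ℕ) × (ℕ × ℕ)) : PairFunction :=
  normalForm (genericMatrix 0) (genericAdjugate 0) (genericMatrix 1) (genericAdjugate 1)
    genericTrace a.1 a.2.1.1 a.2.1.2 a.2.2.1 a.2.2.2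

/-- The exponents of the normal forms of bidegree `(d₁, d₂)`. -/
def normalIndices (d₁ d₂ : ℕ) : Finset ((_ : ℕ) × (ℕ × ℕ) × (ℕ × ℕ)) :=
  (range (min d₁ d₂)).sigma fun e =>
    antidiagonal (d₁ - 1 - e) ×ˢ antidiagonal (d₂ - 1 - e)

lemma normalSpan_generic (d₁ d₂ : ℕ) :
    normalSpan (genericMatrix 0) (genericAdjugate 0) (genericMatrix 1) (genericAdjugate 1)
      genericTrace d₁ d₂ =
      Submodule.span ℂ (Set.range fun a : normalIndices d₁ d₂ => genericNormalForm a) := by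
  rw [normalSpan]
  congr 1
  ext z
  constructor
  · rintro ⟨e, i, k, j, l, h₁, h₂, rfl⟩
    refine ⟨⟨⟨e, (i, k), (j, l)⟩, ?_⟩, rfl⟩
    simp only [normalIndices, mem_sigma, mem_range, mem_product, HasAntidiagonal.mem_antidiagonal]
    omega
  · rintro ⟨⟨⟨e, ⟨i, k⟩, ⟨j, l⟩⟩, ha⟩, rfl⟩
    simp only [normalIndices, mem_sigma, mem_range, mem_product, HasAntidiagonal.mem_antidiagonal] at ha
    exact ⟨e, i, k, j, l, by omega, by omega, rfl⟩

lemma lower_triangular_pow {M : Matrix (Fin 2) (Fin 2) ℂ} (hM : M 0 1 = 0) (n : ℕ) :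
    (M ^ n) 0 0 = M 0 0 ^ n ∧ (M ^ n) 0 1 = 0 := by
  induction n with
  | zero => simp
  | succ n ih => simp [pow_succ, mul_apply, ih.1, ih.2, hM]

lemma upper_triangular_pow {M : Matrix (Fin 2) (Fin 2) ℂ} (hM : M 1 0 = 0) (n : ℕ) :
    (M ^ n) 0 0 = M 0 0 ^ n ∧ (M ^ n) 1 0 = 0 := by
  induction n with
  | zero => simp
  | succ n ih => simp [pow_succ, mul_apply, ih.1, ih.2, hM]

/-- A pair of triangular matrices with eigenvalues `v 1`, `v 2` and `v 3`, `v 4` and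
with trace of the product `v 0`. -/
def triangularPair (v : Fin 5 → ℂ) : Fin 2 → Matrix (Fin 2) (Fin 2) ℂ :=
  ![!![v 1, 0; 1, v 2], !![v 3, v 0 - v 1 * v 3 - v 2 * v 4; 0, v 4]]

/-- Minus the determinant of the commutator of a triangular pair. -/
noncomputable def commutatorDet : MvPolynomial (Fin 5) ℂ :=
  (.X 0 - .X 1 * .X 3 - .X 2 * .X 4) *
    (.X 0 - .X 1 * .X 3 - .X 2 * .X 4 + (.X 1 - .X 2) * (.X 3 - .X 4))

lemma commutatorDet_ne_zero : commutatorDet ≠ 0 := by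
  intro h
  have := congrArg (MvPolynomial.eval ![1, 0, 0, 0, 0]) h
  simp [commutatorDet] at this

/-- The exponent vector of a normal form. -/
noncomputable def normalExponent (a : (_ : ℕ) × (ℕ × ℕ) × (ℕ × ℕ)) : Fin 5 →₀ ℕ :=
  Finsupp.equivFunOnFinite.symm ![a.1, a.2.1.1, a.2.1.2, a.2.2.1, a.2.2.2]

lemma normalExponent_injective : Function.Injective normalExponent := by
  rintro ⟨e, ⟨i, k⟩, ⟨j, l⟩⟩ ⟨e', ⟨i', k'⟩, ⟨j', l'⟩⟩ h
  have h' := Finsupp.equivFunOnFinite.symm.injective h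
  simp only [Matrix.vecCons_inj] at h'
  obtain ⟨rfl, rfl, rfl, rfl, rfl, -⟩ := h'
  rfl

lemma genericNormalForm_triangularPair (a : (_ : ℕ) × (ℕ × ℕ) × (ℕ × ℕ)) (v : Fin 5 → ℂ) :
    (genericNormalForm a (triangularPair v) *
      (triangularPair v 0 * triangularPair v 1 -
        triangularPair v 1 * triangularPair v 0).adjugate) 0 0 =
      -(MvPolynomial.eval v (MvPolynomial.monomial (normalExponent a) 1) *
        MvPolynomial.eval v commutatorDet) := by
  obtain ⟨e, ⟨i, k⟩, ⟨j, l⟩⟩ := a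
  set M := triangularPair v 0 with hM
  set N := triangularPair v 1 with hN
  have ht : (M * N).trace = v 0 := by
    simp [hM, hN, triangularPair, trace_fin_two]
  have hdet : (M * N - N * M).det = -MvPolynomial.eval v commutatorDet := by
    simp [hM, hN, triangularPair, commutatorDet, det_fin_two]
    ring
  have h : genericNormalForm ⟨e, (i, k), (j, l)⟩ (triangularPair v) =
      (v 0 ^ e • (M ^ i * M.adjugate ^ k * (N ^ j * N.adjugate ^ l))) * (M * N - N * M) := by
    simp only [genericNormalForm, normalForm, genericTrace, genericMatrix, genericAdjugate,
      Pi.mul_apply, Pi.pow_apply, Pi.sub_apply, ← hM, ← hN, ht, smul_pow, one_pow, smul_mul_assoc,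
      one_mul]
  rw [h, mul_assoc, mul_adjugate, hdet]
  obtain ⟨h₁, h₂⟩ := lower_triangular_pow (M := M) (by simp [hM, triangularPair]) i
  obtain ⟨h₃, h₄⟩ := lower_triangular_pow (M := M.adjugate)
    (by simp [hM, triangularPair, adjugate_fin_two]) k
  obtain ⟨h₅, h₆⟩ := upper_triangular_pow (M := N) (by simp [hN, triangularPair]) j
  obtain ⟨h₇, h₈⟩ := upper_triangular_pow (M := N.adjugate)
    (by simp [hN, triangularPair, adjugate_fin_two]) l
  have h₉ : M 0 0 = v 1 := by simp [hM, triangularPair]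
  have h₁₀ : M.adjugate 0 0 = v 2 := by simp [hM, triangularPair, adjugate_fin_two]
  have h₁₁ : N 0 0 = v 3 := by simp [hN, triangularPair]
  have h₁₂ : N.adjugate 0 0 = v 4 := by simp [hN, triangularPair, adjugate_fin_two]
  rw [h₉] at h₁
  rw [h₁₀] at h₃
  rw [h₁₁] at h₅
  rw [h₁₂] at h₇
  simp [mul_apply, h₁, h₂, h₃, h₄, h₅, h₆, h₇, h₈, MvPolynomial.eval_monomial, normalExponent,
    Finsupp.prod_fintype, Fin.prod_univ_succ]
  grind

lemma linearIndependent_genericNormalForm : LinearIndependent ℂ genericNormalForm := by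
  rw [linearIndependent_iff']
  intro S g hg a ha
  set P : MvPolynomial (Fin 5) ℂ := ∑ b ∈ S, g b • MvPolynomial.monomial (normalExponent b) 1
    with hP
  have hPD : P * commutatorDet = 0 := by
    refine MvPolynomial.funext fun v => ?_
    have h := congrFun hg (triangularPair v)
    have h' := congrArg (fun Q => (Q * (triangularPair v 0 * triangularPair v 1 -
        triangularPair v 1 * triangularPair v 0).adjugate) 0 0) h
    simp only [Finset.sum_apply, Pi.smul_apply, Finset.sum_mul, Matrix.sum_apply, smul_mul_assoc,
      Matrix.smul_apply, genericNormalForm_triangularPair, Pi.zero_apply, zero_mul,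
      Matrix.zero_apply] at h'
    simp only [hP, map_mul, map_sum, MvPolynomial.smul_eval, map_zero, Finset.sum_mul]
    rw [← neg_eq_zero, ← h', ← Finset.sum_neg_distrib]
    exact Finset.sum_congr rfl fun b _ => by simp only [smul_eq_mul]; ring
  have hP0 : P = 0 := (mul_eq_zero.1 hPD).resolve_right commutatorDet_ne_zero
  have hc := congrArg (MvPolynomial.coeff (normalExponent a)) hP0
  simpa [hP, MvPolynomial.coeff_sum, MvPolynomial.coeff_monomial,
    normalExponent_injective.eq_iff, ha] using hc

lemma finrank_normalSpan_generic (d₁ d₂ : ℕ) :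
    Module.finrank ℂ (normalSpan (genericMatrix 0) (genericAdjugate 0) (genericMatrix 1)
      (genericAdjugate 1) genericTrace d₁ d₂) = (normalIndices d₁ d₂).card := by
  have hli : LinearIndependent ℂ fun a : normalIndices d₁ d₂ => genericNormalForm a :=
    linearIndependent_genericNormalForm.comp _ Subtype.val_injective
  rw [normalSpan_generic, finrank_span_eq_card hli, Fintype.card_coe]

lemma hCoeff_eq (d₁ d₂ : ℕ) : hCoeff d₁ d₂ = 1 + (normalIndices d₁ d₂).card := by
  set m : PairFunction := genericMatrix 0 ^ d₁ * genericMatrix 1 ^ d₂ with hm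
  set N := normalSpan (genericMatrix 0) (genericAdjugate 0) (genericMatrix 1)
      (genericAdjugate 1) genericTrace d₁ d₂ with hN
  have hm1 : m (fun _ => 1) = 1 := by simp [hm, genericMatrix]
  have hm0 : m ≠ 0 := fun h => one_ne_zero (hm1.symm.trans (congrFun h _))
  have hN1 : N ≤ LinearMap.ker (LinearMap.proj (R := ℂ)
      (φ := fun _ : Fin 2 → Matrix (Fin 2) (Fin 2) ℂ => Matrix (Fin 2) (Fin 2) ℂ)
      (fun _ => 1)) := by
    refine Submodule.span_le.2 ?_
    rintro _ ⟨e, i, k, j, l, -, -, rfl⟩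
    simp [normalForm, genericMatrix]
  have hmN : m ∉ N := fun h => one_ne_zero (hm1.symm.trans (hN1 h))
  have hfin : FiniteDimensional ℂ N := by
    rw [hN, normalSpan_generic]
    exact FiniteDimensional.span_of_finite ℂ (Set.finite_range _)
  have hdisj : Submodule.span ℂ {m} ⊓ N = ⊥ :=
    (((Submodule.disjoint_span_singleton' hm0).2 hmN).symm).eq_bot
  have h := Submodule.finrank_sup_add_finrank_inf_eq (Submodule.span ℂ {m}) N
  rw [hdisj, finrank_bot, add_zero, finrank_span_singleton hm0, hN,
    finrank_normalSpan_generic] at h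
  rw [hCoeff_eq_finrank_wordSpan, isQuaternionicPair_generic.wordSpan_eq, h]

lemma card_normalIndices (d₁ d₂ : ℕ) :
    (normalIndices d₁ d₂).card = ∑ e ∈ range (min d₁ d₂), (d₁ - e) * (d₂ - e) := by
  rw [normalIndices, card_sigma]
  refine sum_congr rfl fun e he => ?_
  rw [card_product, Nat.card_antidiagonal, Nat.card_antidiagonal]
  rw [mem_range] at he
  congr 1 <;> omega

lemma hCoeff_zero_left (d : ℕ) : hCoeff 0 d = 1 := by simp [hCoeff_eq, card_normalIndices]

lemma hCoeff_zero_right (d : ℕ) : hCoeff d 0 = 1 := by simp [hCoeff_eq, card_normalIndices]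

lemma hCoeff_succ_succ (d₁ d₂ : ℕ) :
    hCoeff (d₁ + 1) (d₂ + 1) = (d₁ + 1) * (d₂ + 1) + hCoeff d₁ d₂ := by
  simp only [hCoeff_eq, card_normalIndices, Nat.add_min_add_right, sum_range_succ',
    Nat.add_sub_add_right, Nat.sub_zero]
  ring

end Matrices

section PowerSeries

open MvPowerSeries

/-- The power series `∑ f(p, q) t₁^p t₂^q`. -/
def bivariateSeries (f : ℕ → ℕ → ℂ) : MvPowerSeries (Fin 2) ℂ := fun e => f (e 0) (e 1)

lemma coeff_bivariateSeries (f : ℕ → ℕ → ℂ) (e : Fin 2 →₀ ℕ) :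
    coeff e (bivariateSeries f) = f (e 0) (e 1) := rfl

lemma X_zero_mul_bivariateSeries (f : ℕ → ℕ → ℂ) :
    X 0 * bivariateSeries f = bivariateSeries fun p q => if p = 0 then 0 else f (p - 1) q := by
  ext e
  rw [X, coeff_monomial_mul, coeff_bivariateSeries, coeff_bivariateSeries]
  simp only [Finsupp.single_le_iff, Nat.one_le_iff_ne_zero]
  by_cases h : e 0 = 0 <;> simp [h]

lemma X_one_mul_bivariateSeries (f : ℕ → ℕ → ℂ) :
    X 1 * bivariateSeries f = bivariateSeries fun p q => if q = 0 then 0 else f p (q - 1) := by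
  ext e
  rw [X, coeff_monomial_mul, coeff_bivariateSeries, coeff_bivariateSeries]
  simp only [Finsupp.single_le_iff, Nat.one_le_iff_ne_zero]
  by_cases h : e 1 = 0 <;> simp [h]

lemma bivariateSeries_sub (f g : ℕ → ℕ → ℂ) :
    bivariateSeries f - bivariateSeries g = bivariateSeries fun p q => f p q - g p q := rfl

lemma bivariateSeries_delta :
    bivariateSeries (fun p q => if p = 0 ∧ q = 0 then 1 else 0) = 1 := by
  ext e
  rw [coeff_bivariateSeries, coeff_one]
  congr 1
  simp [Finsupp.ext_iff, Fin.forall_fin_two]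

lemma geometric_bivariateSeries :
    (1 - X 0) * (1 - X 1) * bivariateSeries (fun _ _ => 1) = 1 := by
  rw [mul_assoc, sub_mul (1 : MvPowerSeries (Fin 2) ℂ) (X 1), one_mul, X_one_mul_bivariateSeries,
    bivariateSeries_sub, sub_mul, one_mul, X_zero_mul_bivariateSeries, bivariateSeries_sub,
    ← bivariateSeries_delta]
  congr 1
  funext p q
  rcases p with _ | p <;> rcases q with _ | q <;> simp

lemma mul_bivariateSeries :
    (1 - X 0) * (1 - X 1) * bivariateSeries (fun p q => (p : ℂ) * q) =
      X 0 * (X 1 * bivariateSeries fun _ _ => 1) := by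
  rw [mul_assoc, sub_mul (1 : MvPowerSeries (Fin 2) ℂ) (X 1), one_mul, X_one_mul_bivariateSeries,
    bivariateSeries_sub, sub_mul, one_mul, X_zero_mul_bivariateSeries, bivariateSeries_sub,
    X_one_mul_bivariateSeries, X_zero_mul_bivariateSeries]
  congr 1
  funext p q
  rcases p with _ | p <;> rcases q with _ | q <;> simp
  ring

lemma one_sub_mul_hilbertSeries :
    (1 - X 0 * X 1) * (hilbertSeries - bivariateSeries fun _ _ => 1) =
      bivariateSeries fun p q => (p : ℂ) * q := by
  have h : hilbertSeries = bivariateSeries fun p q => (hCoeff p q : ℂ) := rfl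
  rw [h, bivariateSeries_sub, sub_mul, one_mul, mul_assoc, X_one_mul_bivariateSeries,
    X_zero_mul_bivariateSeries, bivariateSeries_sub]
  congr 1
  funext p q
  rcases p with _ | p <;> rcases q with _ | q <;>
    simp [hCoeff_zero_left, hCoeff_zero_right, hCoeff_succ_succ]

end PowerSeries

open MvPowerSeries in
/-- **Formanek's formula** for the Hilbert series of the ring of two generic `2 × 2`
matrices:
`(1−t₁)²(1−t₂)²(1−t₁t₂) H(t₁,t₂) = 1 − t₁ − t₂ + t₁t₂ + t₁²t₂ + t₁t₂² − t₁²t₂²`. -/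
theorem formanek_hilbert_series :
    (1 - X 0) ^ 2 * (1 - X 1) ^ 2 * (1 - X 0 * X 1) * hilbertSeries =
      (1 : MvPowerSeries (Fin 2) ℂ) - X 0 - X 1 + X 0 * X 1
        + X 0 ^ 2 * X 1 + X 0 * X 1 ^ 2 - X 0 ^ 2 * X 1 ^ 2 := by
  linear_combination
    (1 - X 0) ^ 2 * (1 - X 1) ^ 2 * one_sub_mul_hilbertSeries +
    (1 - X 0) * (1 - X 1) * mul_bivariateSeries +
    ((1 - X 0) * (1 - X 1) * (1 - X 0 * X 1) + X 0 * X 1) * geometric_bivariateSeries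
end
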